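/- arXiv:2406.11876 — 4 statements merged into one kernel-verified Lean document; each statement's English description precedes it below -/
import Mathlib

section
/- Let m, n be integers with 2 ≤ m < n. Then the complete bipartite graph K_{m,n} is edge quasi-λ-distance-balanced with λ = (n−1)/(m−1); that is, for every edge f = xy (x in the part of size m, y in the part of size n), m_x(f) = ((n−1)/(m−1))·m_y(f). -/
open SimpleGraph

/-- Distance from a vertex to an edge (unordered pair): min of distances to the endpoints. -/
noncomputable def evdist {V : Type*} (G : SimpleGraph V) (g : V) (e : Sym2 V) : ℕ :=
  Sym2.lift ⟨fun u v => min (G.dist g u) (G.dist g v), fun _ _ => min_comm _ _⟩ e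

/-- `mcount G g h` is the number of edges of `G` strictly closer to `g` than to `h`. -/
noncomputable def mcount {V : Type*} (G : SimpleGraph V) (g h : V) : ℕ :=
  {e ∈ G.edgeSet | evdist G g e < evdist G h e}.ncard

/-- `m0count G g h` is the number of edges of `G`, other than `s(g,h)` itself, that are
equidistant from `g` and from `h`. -/
noncomputable def m0count {V : Type*} (G : SimpleGraph V) (g h : V) : ℕ :=
  {e ∈ G.edgeSet | e ≠ s(g, h) ∧ evdist G g e = evdist G h e}.ncard

/-- `ncount G g h` is the number of vertices of `G` strictly closer to `g` than to `h`. -/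
noncomputable def ncount {V : Type*} (G : SimpleGraph V) (g h : V) : ℕ :=
  {w : V | G.dist w g < G.dist w h}.ncard

/-- Edge quasi-λ-distance-balanced. -/
def IsEQDB {V : Type*} (G : SimpleGraph V) (lam : ℚ) : Prop :=
  ∀ g h : V, G.Adj g h →
    (mcount G g h : ℚ) = lam * mcount G h g ∨ (mcount G h g : ℚ) = lam * mcount G g h

/-- Quasi-λ-distance-balanced. -/
def IsQDB {V : Type*} (G : SimpleGraph V) (lam : ℚ) : Prop :=
  ∀ g h : V, G.Adj g h →
    (ncount G g h : ℚ) = lam * ncount G h g ∨ (ncount G h g : ℚ) = lam * ncount G g h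

theorem evdist_left (m n : ℕ) (x a : Fin m) (b : Fin n) :
    evdist (completeBipartiteGraph (Fin m) (Fin n)) (Sum.inl x) s(Sum.inl a, Sum.inr b)
      = if a = x then 0 else 1 := by
  have h1 : ∀ c : Fin m,
      (completeBipartiteGraph (Fin m) (Fin n)).Adj (Sum.inl c) (Sum.inr b) := by
    intro c; simp
  have h2 := SimpleGraph.dist_eq_one_iff_adj.2 (h1 x)
  simp only [evdist, Sym2.lift_mk, h2]
  split_ifs with h
  · subst h; simp
  · have h3 : (completeBipartiteGraph (Fin m) (Fin n)).Reachable (Sum.inl x) (Sum.inl a) :=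
      (h1 x).reachable.trans (h1 a).reachable.symm
    have h4 := h3.pos_dist_of_ne (by simpa using fun h' => h h'.symm)
    omega

theorem evdist_right (m n : ℕ) (y : Fin n) (a : Fin m) (b : Fin n) :
    evdist (completeBipartiteGraph (Fin m) (Fin n)) (Sum.inr y) s(Sum.inl a, Sum.inr b)
      = if b = y then 0 else 1 := by
  have h1 : ∀ c : Fin n,
      (completeBipartiteGraph (Fin m) (Fin n)).Adj (Sum.inr c) (Sum.inl a) := by
    intro c; simp
  have h2 := SimpleGraph.dist_eq_one_iff_adj.2 (h1 y)
  simp only [evdist, Sym2.lift_mk, h2]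
  split_ifs with h
  · subst h; simp
  · have h3 : (completeBipartiteGraph (Fin m) (Fin n)).Reachable (Sum.inr y) (Sum.inr b) :=
      (h1 y).reachable.trans (h1 b).reachable.symm
    have h4 := h3.pos_dist_of_ne (by simpa using fun h' => h h'.symm)
    omega

theorem edge_form (m n : ℕ) (e : Sym2 (Fin m ⊕ Fin n)) :
    e ∈ (completeBipartiteGraph (Fin m) (Fin n)).edgeSet ↔
      ∃ a b, e = s(Sum.inl a, Sum.inr b) := by
  constructor
  · induction e using Sym2.ind with
    | _ u v =>
      rcases u with u | u <;> rcases v with v | v <;> intro h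
      · simp at h
      · exact ⟨u, v, rfl⟩
      · exact ⟨v, u, Sym2.eq_swap⟩
      · simp at h
  · rintro ⟨a, b, rfl⟩
    simp

theorem mcount_left (m n : ℕ) (x : Fin m) (y : Fin n) :
    mcount (completeBipartiteGraph (Fin m) (Fin n)) (Sum.inl x) (Sum.inr y) = n - 1 := by
  have : {e ∈ (completeBipartiteGraph (Fin m) (Fin n)).edgeSet |
      evdist (completeBipartiteGraph (Fin m) (Fin n)) (Sum.inl x) e <
      evdist (completeBipartiteGraph (Fin m) (Fin n)) (Sum.inr y) e} =
      (fun b : Fin n => (s(Sum.inl x, Sum.inr b) : Sym2 (Fin m ⊕ Fin n))) '' ({y}ᶜ : Set (Fin n)) := by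
    ext e
    simp only [Set.mem_setOf_eq, edge_form, Set.mem_image, Set.mem_compl_iff,
      Set.mem_singleton_iff]
    constructor
    · rintro ⟨⟨a, b, rfl⟩, h⟩
      rw [evdist_left, evdist_right] at h
      split_ifs at h with h1 h2 <;> simp at h
      exact ⟨b, h2, by rw [h1]⟩
    · rintro ⟨b, hb, rfl⟩
      refine ⟨⟨x, b, rfl⟩, ?_⟩
      rw [evdist_left, evdist_right]
      simp [hb]
  rw [mcount, this, Set.ncard_image_of_injective, Set.ncard_compl]
  · simp
  · intro b c h
    simpa using h

theorem mcount_right (m n : ℕ) (x : Fin m) (y : Fin n) :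
    mcount (completeBipartiteGraph (Fin m) (Fin n)) (Sum.inr y) (Sum.inl x) = m - 1 := by
  have : {e ∈ (completeBipartiteGraph (Fin m) (Fin n)).edgeSet |
      evdist (completeBipartiteGraph (Fin m) (Fin n)) (Sum.inr y) e <
      evdist (completeBipartiteGraph (Fin m) (Fin n)) (Sum.inl x) e} =
      (fun a : Fin m => (s(Sum.inl a, Sum.inr y) : Sym2 (Fin m ⊕ Fin n))) '' ({x}ᶜ : Set (Fin m)) := by
    ext e
    simp only [Set.mem_setOf_eq, edge_form, Set.mem_image, Set.mem_compl_iff,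
      Set.mem_singleton_iff]
    constructor
    · rintro ⟨⟨a, b, rfl⟩, h⟩
      rw [evdist_left, evdist_right] at h
      split_ifs at h with h1 h2 <;> simp at h
      exact ⟨a, h2, by rw [h1]⟩
    · rintro ⟨b, hb, rfl⟩
      refine ⟨⟨b, y, rfl⟩, ?_⟩
      rw [evdist_left, evdist_right]
      simp [hb]
  rw [mcount, this, Set.ncard_image_of_injective, Set.ncard_compl]
  · simp
  · intro b c h
    simpa using h

/-- For `2 ≤ m < n`, the complete bipartite graph `K_{m,n}` is edge
quasi-λ-distance-balanced with `λ = (n-1)/(m-1)`: for every edge `f = xy` with `x` in the part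
of size `m` and `y` in the part of size `n`, `m_x(f) = ((n-1)/(m-1)) · m_y(f)`. -/
theorem completeBipartite_isEQDB (m n : ℕ) (hm : 2 ≤ m) (hmn : m < n) :
    IsEQDB (completeBipartiteGraph (Fin m) (Fin n)) (((n : ℚ) - 1) / ((m : ℚ) - 1)) ∧
    ∀ (x : Fin m) (y : Fin n),
      (mcount (completeBipartiteGraph (Fin m) (Fin n)) (Sum.inl x) (Sum.inr y) : ℚ) =
        (((n : ℚ) - 1) / ((m : ℚ) - 1)) *
          (mcount (completeBipartiteGraph (Fin m) (Fin n)) (Sum.inr y) (Sum.inl x) : ℚ) := by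
  have key : ∀ (x : Fin m) (y : Fin n),
      (mcount (completeBipartiteGraph (Fin m) (Fin n)) (Sum.inl x) (Sum.inr y) : ℚ) =
        (((n : ℚ) - 1) / ((m : ℚ) - 1)) *
          (mcount (completeBipartiteGraph (Fin m) (Fin n)) (Sum.inr y) (Sum.inl x) : ℚ) := by
    intro x y
    rw [mcount_left, mcount_right, Nat.cast_sub (by omega), Nat.cast_sub (by omega)]
    have h : (m : ℚ) - 1 ≠ 0 := by
      have : (2 : ℚ) ≤ m := by exact_mod_cast hm
      linarith
    push_cast
    field_simp
  refine ⟨?_, key⟩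
  rintro (g | g) (h | h) hgh
  · simp at hgh
  · exact Or.inl (key g h)
  · exact Or.inr (key h g)
  · simp at hgh
end

section
/- Let A be a finite connected simple graph and λ > 1 a rational number such that A is edge quasi-λ-distance-balanced. Then the edge-Szeged index of A satisfies Sz_e(A) = Σ_{f=gh ∈ E(A)} m_g(f)·m_h(f) = (λ/(λ+1)²) · Σ_{f=gh ∈ E(A)} (|E(A)| − m_0(f) − 1)². -/
open SimpleGraph

private lemma mcount_mul_comm {V : Type*} (G : SimpleGraph V) (g h : V) :
    mcount G g h * mcount G h g = mcount G h g * mcount G g h := mul_comm _ _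

private lemma m0count_comm {V : Type*} (G : SimpleGraph V) (g h : V) :
    m0count G g h = m0count G h g := by
  unfold m0count
  congr 1
  ext e
  simp only [Set.mem_setOf_eq]
  constructor <;> rintro ⟨he, hne, heq⟩ <;>
    exact ⟨he, by rwa [Sym2.eq_swap], heq.symm⟩

/-- The contribution `m_g(f)·m_h(f)` of an edge `f = gh`, as a function of the unordered edge. -/
noncomputable def mprod {V : Type*} (G : SimpleGraph V) : Sym2 V → ℕ :=
  Sym2.lift ⟨fun g h => mcount G g h * mcount G h g, fun g h => mcount_mul_comm G g h⟩

/-- The value `m_0(f)` of an edge `f = gh`, as a function of the unordered edge. -/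
noncomputable def m0edge {V : Type*} (G : SimpleGraph V) : Sym2 V → ℕ :=
  Sym2.lift ⟨fun g h => m0count G g h, fun g h => m0count_comm G g h⟩

lemma mcount_total {V : Type*} [Finite V] (G : SimpleGraph V) (g h : V) (hgh : G.Adj g h) :
    mcount G g h + mcount G h g + m0count G g h + 1 = G.edgeSet.ncard := by
  have he : evdist G g s(g, h) = evdist G h s(g, h) := by
    simp [evdist]
  have hU : G.edgeSet = (({e ∈ G.edgeSet | evdist G g e < evdist G h e} ∪
      {e ∈ G.edgeSet | evdist G h e < evdist G g e}) ∪
      {e ∈ G.edgeSet | e ≠ s(g, h) ∧ evdist G g e = evdist G h e}) ∪ {s(g, h)} := by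
    ext e
    simp only [Set.mem_union, Set.mem_setOf_eq, Set.mem_singleton_iff]
    constructor
    · intro hm
      by_cases h1 : e = s(g, h)
      · exact Or.inr h1
      · rcases lt_trichotomy (evdist G g e) (evdist G h e) with h2 | h2 | h2 <;> tauto
    · rintro (((h1 | h1) | h1) | h1)
      · exact h1.1
      · exact h1.1
      · exact h1.1
      · rw [h1]; exact hgh
  rw [hU, Set.ncard_union_eq, Set.ncard_union_eq, Set.ncard_union_eq, Set.ncard_singleton]
  · rfl
  · rw [Set.disjoint_left]
    rintro e ⟨_, h1⟩ ⟨_, h2⟩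
    omega
  · rw [Set.disjoint_left]
    rintro e (⟨_, h1⟩ | ⟨_, h1⟩) ⟨_, _, h2⟩ <;> omega
  · rw [Set.disjoint_left]
    rintro e ((⟨_, h1⟩ | ⟨_, h1⟩) | ⟨_, h1, _⟩) h2
    · rw [Set.mem_singleton_iff.1 h2] at h1; omega
    · rw [Set.mem_singleton_iff.1 h2] at h1; omega
    · exact h1 h2

/-- If a finite connected graph `A` is edge quasi-λ-distance-balanced for a
rational `λ > 1`, then its edge-Szeged index satisfies
`Sz_e(A) = Σ_{f=gh} m_g(f)·m_h(f) = (λ/(λ+1)²) · Σ_{f=gh} (|E(A)| - m_0(f) - 1)²`. -/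
theorem edgeSzeged_of_eqdb {V : Type*} [Fintype V] [DecidableEq V]
    (G : SimpleGraph V) [DecidableRel G.Adj] (hconn : G.Connected)
    (lam : ℚ) (hlam : 1 < lam) (hEQDB : IsEQDB G lam) :
    ∑ e ∈ G.edgeFinset, (mprod G e : ℚ) =
      (lam / (lam + 1) ^ 2) *
        ∑ e ∈ G.edgeFinset, ((G.edgeSet.ncard : ℚ) - (m0edge G e : ℚ) - 1) ^ 2 := by
  rw [Finset.mul_sum]
  refine Finset.sum_congr rfl fun e he => ?_
  induction e using Sym2.ind with
  | _ g h =>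
    have hgh : G.Adj g h := by simpa using he
    have ht := mcount_total G g h hgh
    have hq : (G.edgeSet.ncard : ℚ) - (m0count G g h : ℚ) - 1
        = mcount G g h + mcount G h g := by
      rw [← ht]; push_cast; ring
    have h0 : lam + 1 ≠ 0 := by linarith
    change ((mcount G g h * mcount G h g : ℕ) : ℚ) = (lam / (lam + 1) ^ 2) *
      ((G.edgeSet.ncard : ℚ) - (m0count G g h : ℚ) - 1) ^ 2
    rw [hq]
    push_cast
    rcases hEQDB g h hgh with h1 | h1 <;> rw [h1] <;> field_simp <;> ring
end

section
/- Let A and B be finite connected simple graphs, let a_1 a_2 be an edge of A and b a vertex of B. Then in the Cartesian (box) product A □ B, the edge F = (a_1,b)(a_2,b) satisfies m_{(a_1,b)}^{A□B}(F) = m_{a_1}^A(a_1 a_2)·|V(B)| + n_{a_1}^A(a_1 a_2)·|E(B)|, where |V(B)| and |E(B)| are the numbers of vertices and edges of B. -/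
open SimpleGraph

theorem dist_boxProd_aux {α β : Type*} (G : SimpleGraph α) (H : SimpleGraph β)
    (hG : G.Connected) (hH : H.Connected) (x y : α × β) :
    (G □ H).dist x y = G.dist x.1 y.1 + H.dist x.2 y.2 := by
  unfold SimpleGraph.dist
  rw [edist_boxProd, ENat.toNat_add]
  · exact edist_ne_top_iff_reachable.mpr (hG x.1 y.1)
  · exact edist_ne_top_iff_reachable.mpr (hH x.2 y.2)

/-- For an edge `a₁a₂` of `A` and a vertex `b` of `B`, the edge
`(a₁,b)(a₂,b)` of the box product `A □ B` satisfies
`m_{(a₁,b)}(F) = m_{a₁}(a₁a₂)·|V(B)| + n_{a₁}(a₁a₂)·|E(B)|`. -/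
theorem boxProd_mcount {α β : Type*} [Fintype α] [Fintype β]
    (G : SimpleGraph α) (H : SimpleGraph β) (hG : G.Connected) (hH : H.Connected)
    (a₁ a₂ : α) (hadj : G.Adj a₁ a₂) (b : β) :
    mcount (G □ H) (a₁, b) (a₂, b) =
      mcount G a₁ a₂ * Fintype.card β + ncount G a₁ a₂ * H.edgeSet.ncard := by
  have key : {e ∈ (G □ H).edgeSet | evdist (G □ H) (a₁, b) e < evdist (G □ H) (a₂, b) e} =
      (fun p : Sym2 α × β => p.1.map (fun x => (x, p.2))) ''
        ({e ∈ G.edgeSet | evdist G a₁ e < evdist G a₂ e} ×ˢ (Set.univ : Set β)) ∪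
      (fun p : α × Sym2 β => p.2.map (fun y => (p.1, y))) ''
        ({w : α | G.dist w a₁ < G.dist w a₂} ×ˢ H.edgeSet) := by
    ext e
    constructor
    · induction e using Sym2.ind with
      | _ u v =>
      obtain ⟨x, y⟩ := u
      obtain ⟨x', y'⟩ := v
      rintro ⟨h1, h2⟩
      simp only [evdist, Sym2.lift_mk, dist_boxProd_aux G H hG hH] at h2
      rw [mem_edgeSet, boxProd_adj] at h1
      dsimp only at h1 h2
      rcases h1 with ⟨h1, rfl⟩ | ⟨h1, rfl⟩
      · refine Or.inl ⟨(s(x, x'), y), ⟨⟨h1, ?_⟩, Set.mem_univ _⟩, by simp⟩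
        simp only [evdist, Sym2.lift_mk]
        omega
      · refine Or.inr ⟨(x, s(y, y')), ⟨?_, h1⟩, by simp⟩
        simp only [Set.mem_setOf_eq]
        rw [G.dist_comm (u := x) (v := a₁), G.dist_comm (u := x) (v := a₂)]
        omega
    · rintro (⟨⟨e, y⟩, ⟨⟨h1, h2⟩, -⟩, rfl⟩ | ⟨⟨x, e⟩, ⟨h1, h2⟩, rfl⟩)
      · induction e using Sym2.ind with
        | _ u v =>
        simp only [evdist, Sym2.lift_mk] at h2
        refine ⟨by simpa [boxProd_adj] using h1, ?_⟩
        simp only [evdist, Sym2.map_mk, Sym2.lift_mk, dist_boxProd_aux G H hG hH]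
        omega
      · induction e using Sym2.ind with
        | _ u v =>
        simp only [Set.mem_setOf_eq] at h1
        rw [G.dist_comm (u := x) (v := a₁), G.dist_comm (u := x) (v := a₂)] at h1
        refine ⟨by simpa [boxProd_adj] using h2, ?_⟩
        simp only [evdist, Sym2.map_mk, Sym2.lift_mk, dist_boxProd_aux G H hG hH]
        omega
  have i1 : Function.Injective (fun p : Sym2 α × β => p.1.map (fun x => (x, p.2))) := by
    rintro ⟨e, y⟩ ⟨e', y'⟩ h
    induction e using Sym2.ind with
    | _ u v =>
    induction e' using Sym2.ind with
    | _ u' v' =>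
    simp at h ⊢
    tauto
  have i2 : Function.Injective (fun p : α × Sym2 β => p.2.map (fun y => (p.1, y))) := by
    rintro ⟨y, e⟩ ⟨y', e'⟩ h
    induction e using Sym2.ind with
    | _ u v =>
    induction e' using Sym2.ind with
    | _ u' v' =>
    simp at h ⊢
    tauto
  unfold mcount ncount
  rw [key, Set.ncard_union_eq _ (Set.toFinite _) (Set.toFinite _),
    Set.ncard_image_of_injective _ i1, Set.ncard_image_of_injective _ i2,
    Set.ncard_prod, Set.ncard_prod, Set.ncard_univ, Nat.card_eq_fintype_card]
  rw [Set.disjoint_left]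
  rintro _ ⟨⟨e, y⟩, ⟨⟨h1, -⟩, -⟩, rfl⟩ ⟨⟨x, e'⟩, ⟨-, -⟩, h⟩
  induction e using Sym2.ind with
  | _ u v =>
  induction e' using Sym2.ind with
  | _ u' v' =>
  have h3 := G.ne_of_adj h1
  simp at h
  grind
end

section
/- Let A be a finite connected simple graph of diameter d that is nicely edge quasi-λ-distance-balanced (λ-NQEDB) with constant γ' and rational λ > 1. Then d − 1 ≤ λ·γ'. -/
open SimpleGraph

/-- Nicely edge quasi-λ-distance-balanced with constant `γ'`: for every edge `f = gh`, one of
`m_g(f)`, `m_h(f)` equals `γ'` and the other equals `λ·γ'`. -/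
def IsNQEDB {V : Type*} (G : SimpleGraph V) (lam : ℚ) (γ' : ℕ) : Prop :=
  ∀ g h : V, G.Adj g h →
    (mcount G g h = γ' ∧ (mcount G h g : ℚ) = lam * γ') ∨
    (mcount G h g = γ' ∧ (mcount G g h : ℚ) = lam * γ')

/-- Nicely quasi-λ-distance-balanced with constant `γ`: for every edge `f = gh`, one of
`n_g(f)`, `n_h(f)` equals `γ` and the other equals `λ·γ`. -/
def IsNQDB {V : Type*} (G : SimpleGraph V) (lam : ℚ) (γ : ℕ) : Prop :=
  ∀ g h : V, G.Adj g h →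
    (ncount G g h = γ ∧ (ncount G h g : ℚ) = lam * γ) ∨
    (ncount G h g = γ ∧ (ncount G g h : ℚ) = lam * γ)

theorem aux_step {V : Type*} (G : SimpleGraph V) (hconn : G.Connected) (f : ℕ → V) (d : ℕ)
    (hf : ∀ i, i < d → G.Adj (f i) (f (i+1))) (i k : ℕ) (h : i + k ≤ d) :
    G.dist (f i) (f (i+k)) ≤ k := by
  induction k with
  | zero => simp
  | succ k ih =>
    have h1 := ih (by omega)
    have h2 := SimpleGraph.dist_eq_one_iff_adj.2 (hf (i+k) (by omega))
    have h3 := hconn.dist_triangle (u := f i) (v := f (i+k)) (w := f (i+k+1))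
    rw [← add_assoc]
    omega

theorem aux_count {V : Type*} [Fintype V] (G : SimpleGraph V) (hconn : G.Connected) (f : ℕ → V)
    (d : ℕ) (hf : ∀ i, i < d → G.Adj (f i) (f (i+1))) (hd : G.dist (f 0) (f d) = d) :
    d - 1 ≤ mcount G (f 1) (f 0) := by
  have h0 : ∀ i, i ≤ d → G.dist (f 0) (f i) = i := by
    intro i hi
    have h1 := aux_step G hconn f d hf 0 i (by omega)
    have h2 := aux_step G hconn f d hf i (d - i) (by omega)
    have h3 := hconn.dist_triangle (u := f 0) (v := f i) (w := f d)
    rw [zero_add] at h1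
    rw [show i + (d - i) = d by omega] at h2
    omega
  have e0 : ∀ i, i + 2 ≤ d → evdist G (f 0) s(f (i+1), f (i+2)) = i + 1 := by
    intro i hi
    simp only [evdist, Sym2.lift_mk]
    rw [h0 _ (by omega), h0 _ (by omega)]
    omega
  have e1 : ∀ i, i + 2 ≤ d → evdist G (f 1) s(f (i+1), f (i+2)) ≤ i := by
    intro i hi
    simp only [evdist, Sym2.lift_mk]
    have := aux_step G hconn f d hf 1 i (by omega)
    rw [add_comm 1 i] at this
    exact (min_le_left _ _).trans this
  unfold mcount
  have key := Set.ncard_le_ncard_of_injOn (s := (Finset.range (d-1) : Set ℕ))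
    (t := {e ∈ G.edgeSet | evdist G (f 1) e < evdist G (f 0) e})
    (fun i => s(f (i+1), f (i+2))) ?_ ?_ (Set.toFinite _)
  · rwa [Set.ncard_coe_finset, Finset.card_range] at key
  · intro i hi
    have hi : i < d - 1 := by simpa using hi
    refine ⟨hf (i+1) (by omega), ?_⟩
    have := e0 i (by omega)
    have := e1 i (by omega)
    show evdist G (f 1) s(f (i+1), f (i+2)) < evdist G (f 0) s(f (i+1), f (i+2))
    omega
  · intro i hi j hj hij
    have hi : i < d - 1 := by simpa using hi
    have hj : j < d - 1 := by simpa using hj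
    have a := e0 i (by omega)
    have b := e0 j (by omega)
    have hij : s(f (i+1), f (i+2)) = s(f (j+1), f (j+2)) := hij
    rw [hij] at a
    omega

/-- If a finite connected graph `A` of diameter `d` is nicely edge
quasi-λ-distance-balanced with constant `γ'` (`λ ∈ ℚ`, `λ > 1`), then `d - 1 ≤ λ·γ'`. -/
theorem nqedb_diam_le {V : Type*} [Fintype V] (G : SimpleGraph V) (hconn : G.Connected)
    (lam : ℚ) (hlam : 1 < lam) (γ' : ℕ) (hN : IsNQEDB G lam γ') :
    (G.diam : ℚ) - 1 ≤ lam * γ' := by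
  have hnn : (0:ℚ) ≤ lam * γ' := by positivity
  have : Nonempty V := hconn.nonempty
  obtain ⟨u, v, huv⟩ := G.exists_dist_eq_diam
  obtain ⟨p, hp⟩ := hconn.exists_walk_length_eq_dist u v
  rcases Nat.eq_zero_or_pos G.diam with h | h
  · rw [h]; push_cast; linarith
  have hl : p.length = G.diam := hp.trans huv
  have hf : ∀ i, i < G.diam → G.Adj (p.getVert i) (p.getVert (i+1)) :=
    fun i hi => p.adj_getVert_succ (by omega)
  have hc := aux_count G hconn p.getVert G.diam hf (by
    rw [← hl, p.getVert_zero, p.getVert_length, hp])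
  have hc' : (G.diam : ℚ) - 1 ≤ mcount G (p.getVert 1) (p.getVert 0) := by
    have : G.diam ≤ mcount G (p.getVert 1) (p.getVert 0) + 1 := by omega
    have : (G.diam : ℚ) ≤ mcount G (p.getVert 1) (p.getVert 0) + 1 := by exact_mod_cast this
    linarith
  rcases hN _ _ (hf 0 h) with ⟨_, h2⟩ | ⟨h1, _⟩
  · exact hc'.trans h2.le
  · rw [zero_add] at h1
    rw [h1] at hc'
    have : (0:ℚ) ≤ γ' := by positivity
    nlinarith
end
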